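/- Fix real parameters u₀, v₀, p₀, γ̃₁, γ̃₂ (γ̃ varying affinely along the path), a direction n = (n_x, n_y), and two states V⁻ = (ρ⁻, u₀, v₀, p₀, χ⁻) and V⁺ = (ρ⁺, u₀, v₀, p₀, χ⁺) with ρ⁻ > 0 and ρ⁺ > 0, sharing the same velocity and pressure. Let Ψ(s) = V⁻ + s (V⁺ − V⁻) for s ∈ [0,1] be the segment path, and for a state V = (ρ,u,v,p,χ) with ρ ≠ 0 let A_V(V; γ̃), B_V(V; γ̃) be the primitive quasilinear matrices of the multi-material Euler system (A_V with rows (u,ρ,0,0,0), (0,u,0,1/ρ,0), (0,0,u,0,0), (0,γ̃p,0,u,0), (0,0,0,0,u), and B_V analogously), where along the path γ̃ = γ̃(s) is any function of s. Then for every s ∈ [0,1], (A_V(Ψ(s); γ̃(s)) n_x + B_V(Ψ(s); γ̃(s)) n_y) (V⁺ − V⁻) = (u₀ n_x + v₀ n_y) (V⁺ − V⁻); consequently the segment-path integral satisfies ( ∫₀¹ [A_V(Ψ(s); γ̃(s)) n_x + B_V(Ψ(s); γ̃(s)) n_y] ds ) (V⁺ − V⁻) = (u₀ n_x + v₀ n_y)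 (V⁺ − V⁻). -/

import Mathlib

open Matrix

/-- Primitive quasilinear matrix A_V of the multi-material Euler system,
evaluated at the state W = (ρ,u,v,p,χ) with EOS parameter γ̃. -/
noncomputable def AVmat (W : Fin 5 → ℝ) (γt : ℝ) : Matrix (Fin 5) (Fin 5) ℝ :=
  !![W 1, W 0, 0, 0, 0;
     0, W 1, 0, 1 / W 0, 0;
     0, 0, W 1, 0, 0;
     0, γt * W 3, 0, W 1, 0;
     0, 0, 0, 0, W 1]

/-- Primitive quasilinear matrix B_V of the multi-material Euler system. -/
noncomputable def BVmat (W : Fin 5 → ℝ) (γt : ℝ) : Matrix (Fin 5) (Fin 5) ℝ :=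
  !![W 2, 0, W 0, 0, 0;
     0, W 2, 0, 0, 0;
     0, 0, W 2, 1 / W 0, 0;
     0, 0, γt * W 3, W 2, 0;
     0, 0, 0, 0, W 2]

/-- Segment path Ψ(s) = V⁻ + s (V⁺ − V⁻). -/
noncomputable def segPath (Vm Vp : Fin 5 → ℝ) (s : ℝ) : Fin 5 → ℝ :=
  Vm + s • (Vp - Vm)

/-- Normal primitive matrix along the segment path, with γ̃ varying affinely. -/
noncomputable def pathMat (Vm Vp : Fin 5 → ℝ) (g₁ g₂ nx ny s : ℝ) :
    Matrix (Fin 5) (Fin 5) ℝ :=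
  nx • AVmat (segPath Vm Vp s) (g₁ + s * (g₂ - g₁))
    + ny • BVmat (segPath Vm Vp s) (g₁ + s * (g₂ - g₁))

theorem pathMat_mulVec_contact_jump (u₀ v₀ p₀ g₁ g₂ nx ny ρm ρp χm χp s : ℝ) :
    (pathMat ![ρm, u₀, v₀, p₀, χm] ![ρp, u₀, v₀, p₀, χp] g₁ g₂ nx ny s).mulVec
        (![ρp, u₀, v₀, p₀, χp] - ![ρm, u₀, v₀, p₀, χm])
      = (u₀ * nx + v₀ * ny) • (![ρp, u₀, v₀, p₀, χp] - ![ρm, u₀, v₀, p₀, χm]) := by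
  ext i
  fin_cases i <;>
    simp [pathMat, AVmat, BVmat, segPath, mulVec, dotProduct, Fin.sum_univ_five,
      mul_comm, -mul_eq_mul_right_iff, -mul_eq_mul_left_iff]

/-- Across a contact (same velocity and pressure on the two sides), the normal
primitive matrix along the segment path applied to the jump equals the normal
velocity times the jump, pointwise in s and after path integration. -/
theorem segment_path_contact
    (u₀ v₀ p₀ g₁ g₂ nx ny ρm ρp χm χp : ℝ) (hρm : 0 < ρm) (hρp : 0 < ρp) :
    (∀ s ∈ Set.Icc (0 : ℝ) 1,
      (pathMat ![ρm, u₀, v₀, p₀, χm] ![ρp, u₀, v₀, p₀, χp] g₁ g₂ nx ny s).mulVec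
          (![ρp, u₀, v₀, p₀, χp] - ![ρm, u₀, v₀, p₀, χm])
        = (u₀ * nx + v₀ * ny) • (![ρp, u₀, v₀, p₀, χp] - ![ρm, u₀, v₀, p₀, χm]))
    ∧ (Matrix.of fun i j => ∫ s in (0 : ℝ)..1,
          pathMat ![ρm, u₀, v₀, p₀, χm] ![ρp, u₀, v₀, p₀, χp] g₁ g₂ nx ny s i j).mulVec
          (![ρp, u₀, v₀, p₀, χp] - ![ρm, u₀, v₀, p₀, χm])
        = (u₀ * nx + v₀ * ny) • (![ρp, u₀, v₀, p₀, χp] - ![ρm, u₀, v₀, p₀, χm]) := by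
  refine ⟨fun s _ => pathMat_mulVec_contact_jump .., ?_⟩
  ext i
  fin_cases i <;>
    simp [pathMat, AVmat, BVmat, segPath, mulVec, dotProduct, Fin.sum_univ_five,
      mul_comm, -mul_eq_mul_right_iff, -mul_eq_mul_left_iff]
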